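/- Let n ≥ 1 and 1 ≤ c ≤ n, and let B₂ := {γ ∈ ℕ^n : |γ| = 2 and Σ_{j=1}^c γ_j ≥ 1}. Define Y := { α + α' + e_i : α, α' ∈ B₂, 1 ≤ i ≤ n } and E₁ := { (α+e_i, β+e_j) : α ∈ B₂, β ∈ {e_1,…,e_n}, i ≠ j, β+e_j ∉ B₂, β+e_i ∈ B₂ }. Then |Y| = C(c+4,5) + (n−c)·C(c+3,4) + C(n−c+1,2)·C(c+2,3) + C(n−c+2,3)·C(c+1,2), and |E₁| = C(n−c+1,2)·( C(c+2,3) + (n−c)·C(c+1,2) ). -/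

import Mathlib

open scoped BigOperators

/-- The sum `γ_𝒞 = Σ_{j=1}^c γ_j` of the first `c` coordinates of a multi-index. -/
def csum (n c : ℕ) (γ : Fin n → ℕ) : ℕ :=
  ∑ j ∈ Finset.univ.filter (fun j : Fin n => (j : ℕ) < c), γ j

/-- The degree-2 part `B₂` of the set of the first `r = Σ_{j=0}^c (n−j+1)` exponent
vectors in graded lexicographic order. -/
def B2 (n c : ℕ) : Set (Fin n → ℕ) :=
  {γ | (∑ j, γ j = 2) ∧ 1 ≤ csum n c γ}

/-- The set `Y` of moment variables. -/
def Yset (n c : ℕ) : Set (Fin n → ℕ) :=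
  {γ | ∃ α ∈ B2 n c, ∃ α' ∈ B2 n c, ∃ i : Fin n, γ = α + α' + Pi.single i 1}

/-- The index set `E₁` of the linear determinantal relations. -/
def E1set (n c : ℕ) : Set ((Fin n → ℕ) × (Fin n → ℕ)) :=
  {q | ∃ α ∈ B2 n c, ∃ b i j : Fin n, i ≠ j ∧
        Pi.single b 1 + Pi.single j 1 ∉ B2 n c ∧
        Pi.single b 1 + Pi.single i 1 ∈ B2 n c ∧
        q = (α + Pi.single i 1, Pi.single b 1 + Pi.single j 1)}


def Tset (m d : ℕ) : Set (Fin m → ℕ) := {f | ∑ i, f i = d}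

lemma Tset_finite (m d : ℕ) : (Tset m d).Finite := by
  have : Tset m d = ↑(Finset.finAntidiagonal m d) := by
    ext f; simp [Tset]
  rw [this]; exact Finset.finite_toSet _

lemma Tset_ncard (m d : ℕ) : (Tset m d).ncard = Nat.multichoose m d := by
  rw [← Nat.card_coe_set_eq]
  have h := Nat.card_congr (Sym.equivNatSumOfFintype (Fin m) d)
  rw [← Sym.card_sym_fin_eq_multichoose m d, ← Nat.card_eq_fintype_card, h]
  rfl

def Sset (n c a t : ℕ) : Set (Fin n → ℕ) := {γ | csum n c γ = a ∧ ∑ i, γ i = t}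

lemma Sset_finite (n c a t : ℕ) : (Sset n c a t).Finite :=
  (Tset_finite n t).subset (fun _ h => h.2)

lemma csum_append (c m : ℕ) (f : Fin c → ℕ) (g : Fin m → ℕ) :
    csum (c+m) c (Fin.append f g) = ∑ i, f i := by
  unfold csum
  rw [Finset.sum_filter, Fin.sum_univ_add]
  simp

lemma Sset_ncard (c m a b : ℕ) :
    (Sset (c+m) c a (a+b)).ncard = Nat.multichoose m b * Nat.multichoose c a := by
  have : Sset (c+m) c a (a+b) = (Fin.appendEquiv c m) '' (Tset c a ×ˢ Tset m b) := by
    ext γ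
    obtain ⟨⟨f, g⟩, rfl⟩ := (Fin.appendEquiv c m).surjective γ
    rw [Set.mem_image_equiv, Equiv.symm_apply_apply]
    change (csum (c+m) c (Fin.append f g) = a ∧ ∑ i, Fin.append f g i = a + b) ↔ 
      (∑ i, f i = a ∧ ∑ i, g i = b)
    rw [csum_append, Fin.sum_univ_add]
    simp only [Fin.append_left, Fin.append_right]
    omega
  rw [this, Set.ncard_image_of_injective _ (Equiv.injective _), Set.ncard_prod, Tset_ncard,
    Tset_ncard, mul_comm]

lemma csum_add (n c : ℕ) (f g : Fin n → ℕ) : csum n c (f + g) = csum n c f + csum n c g := by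
  simp [csum, Finset.sum_add_distrib]

lemma csum_single (n c : ℕ) (i : Fin n) :
    csum n c (Pi.single i 1) = if (i : ℕ) < c then 1 else 0 := by
  simp [csum, Finset.sum_pi_single]

lemma csum_le (n c : ℕ) (f : Fin n → ℕ) : csum n c f ≤ ∑ i, f i :=
  Finset.sum_le_sum_of_subset (Finset.filter_subset _ _)

lemma sum_add' {n : ℕ} (f g : Fin n → ℕ) : ∑ i, (f + g) i = ∑ i, f i + ∑ i, g i := by
  simp [Finset.sum_add_distrib]

lemma sum_single' {n : ℕ} (i : Fin n) : ∑ j, (Pi.single i 1 : Fin n → ℕ) j = 1 := by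
  simp

lemma peel {n : ℕ} (s : Finset (Fin n)) (γ : Fin n → ℕ) (h : 1 ≤ ∑ j ∈ s, γ j) :
    ∃ i ∈ s, ∃ δ : Fin n → ℕ, γ = δ + Pi.single i 1 := by
  obtain ⟨i, hi, h0⟩ := Finset.exists_ne_zero_of_sum_ne_zero (by omega : ∑ j ∈ s, γ j ≠ 0)
  refine ⟨i, hi, γ - Pi.single i 1, ?_⟩
  ext j
  by_cases hj : j = i
  · subst hj; simp; omega
  · simp [hj]

lemma peelC {n c : ℕ} (γ : Fin n → ℕ) (a t : ℕ) (h : csum n c γ = a + 1)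
    (ht : ∑ i, γ i = t + 1) :
    ∃ i : Fin n, (i : ℕ) < c ∧ ∃ δ : Fin n → ℕ, γ = δ + Pi.single i 1 ∧
      csum n c δ = a ∧ ∑ i, δ i = t := by
  obtain ⟨i, hi, δ, rfl⟩ := peel (Finset.univ.filter (fun j : Fin n => (j : ℕ) < c)) γ
    (by unfold csum at h; omega)
  have hi' : (i : ℕ) < c := by simpa using hi
  rw [csum_add, csum_single, if_pos hi'] at h
  rw [sum_add', sum_single'] at ht
  exact ⟨i, hi', δ, rfl, by omega, by omega⟩

lemma peelU {n c : ℕ} (γ : Fin n → ℕ) (t : ℕ) (ht : ∑ i, γ i = t + 1) :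
    ∃ i : Fin n, ∃ δ : Fin n → ℕ, γ = δ + Pi.single i 1 ∧ ∑ i, δ i = t := by
  obtain ⟨i, hi, δ, rfl⟩ := peel Finset.univ γ (by omega)
  rw [sum_add', sum_single'] at ht
  exact ⟨i, δ, rfl, by omega⟩

lemma mem_Y_iff (n c : ℕ) (γ : Fin n → ℕ) :
    γ ∈ Yset n c ↔ 2 ≤ csum n c γ ∧ ∑ i, γ i = 5 := by
  constructor
  · rintro ⟨α, ⟨h1, h2⟩, α', ⟨h3, h4⟩, i, rfl⟩
    rw [csum_add, csum_add, sum_add', sum_add', sum_single']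
    omega
  · rintro ⟨h, ht⟩
    obtain ⟨i, hi, δ, rfl, h1, ht1⟩ := peelC (c := c) γ (csum n c γ - 1) 4 (by omega) (by omega)
    rw [csum_add, csum_single, if_pos hi] at h
    obtain ⟨j, hj, δ, rfl, h2, ht2⟩ := peelC (c := c) δ (csum n c δ - 1) 3 (by omega) (by omega)
    obtain ⟨k, δ, rfl, ht3⟩ := peelU (c := c) δ 2 (by omega)
    obtain ⟨l, δ, rfl, ht4⟩ := peelU (c := c) δ 1 (by omega)
    obtain ⟨p, δ, rfl, ht5⟩ := peelU (c := c) δ 0 (by omega)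
    have h0 : δ = 0 := by
      ext x
      simpa using (Finset.sum_eq_zero_iff.mp ht5) x (Finset.mem_univ x)
    subst h0
    refine ⟨Pi.single i 1 + Pi.single k 1, ⟨?_, ?_⟩, Pi.single j 1 + Pi.single l 1, ⟨?_, ?_⟩, p, ?_⟩
    · rw [sum_add', sum_single', sum_single']
    · rw [csum_add, csum_single, if_pos hi]; omega
    · rw [sum_add', sum_single', sum_single']
    · rw [csum_add, csum_single, if_pos hj]; omega
    · abel

lemma Sset_disj (n c a a' t t' : ℕ) (h : a ≠ a') : Disjoint (Sset n c a t) (Sset n c a' t') := by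
  rw [Set.disjoint_left]
  rintro γ ⟨h1, _⟩ ⟨h2, _⟩
  omega

lemma Y_eq (n c : ℕ) : Yset n c =
    Sset n c 5 5 ∪ (Sset n c 4 5 ∪ (Sset n c 3 5 ∪ Sset n c 2 5)) := by
  ext γ
  rw [mem_Y_iff]
  have := csum_le n c γ
  simp only [Sset, Set.mem_union, Set.mem_ofPred_eq]
  omega

lemma E_eq (n c : ℕ) : E1set n c = (Sset n c 3 3 ∪ Sset n c 2 3) ×ˢ Sset n c 0 2 := by
  ext ⟨γ, δ⟩
  constructor
  · rintro ⟨α, ⟨h1, h2⟩, b, i, j, hij, hbj, hbi, hq⟩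
    obtain ⟨rfl, rfl⟩ := Prod.mk.inj hq
    have hle := csum_le n c α
    change ¬ (_ = 2 ∧ 1 ≤ _) at hbj
    change (_ = 2 ∧ 1 ≤ _) at hbi
    rw [csum_add, sum_add', sum_single', sum_single', csum_single, csum_single] at hbj hbi
    change ((_ = 3 ∧ _ = 3) ∨ (_ = 2 ∧ _ = 3)) ∧ (_ = 0 ∧ _ = 2)
    dsimp only
    rw [csum_add, csum_add, sum_add', sum_add', sum_single', sum_single', sum_single',
      csum_single, csum_single, csum_single]
    split_ifs at * <;> omega
  · rintro ⟨hγ, h0, ht⟩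
    simp only [Sset, Set.mem_union, Set.mem_ofPred_eq] at hγ h0 ht
    obtain ⟨i, hi, α, rfl, h1, ht1⟩ := peelC (c := c) γ (csum n c γ - 1) 2 (by omega) (by omega)
    rw [csum_add, csum_single, if_pos hi] at hγ
    obtain ⟨j, δ, rfl, ht3⟩ := peelU (c := c) δ 1 (by omega)
    obtain ⟨b, δ, rfl, ht4⟩ := peelU (c := c) δ 0 (by omega)
    have hd : δ = 0 := by
      ext x
      simpa using (Finset.sum_eq_zero_iff.mp ht4) x (Finset.mem_univ x)
    subst hd
    rw [zero_add, csum_add, csum_single, csum_single] at h0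
    have hj : ¬ (j : ℕ) < c := by split_ifs at h0 <;> omega
    have hb : ¬ (b : ℕ) < c := by split_ifs at h0 <;> omega
    refine ⟨α, ⟨ht1, by omega⟩, b, i, j, ?_, ?_, ?_, by rw [zero_add]⟩
    · rintro rfl; exact hj hi
    · simp [B2, csum_add, csum_single, hj, hb]
    · refine ⟨by rw [sum_add', sum_single', sum_single'], ?_⟩
      rw [csum_add, csum_single, csum_single, if_pos hi]; omega

/-- Counts of the moment variables `Y` and of the linear relations `E₁` for order-4
tensors, for the monomial set consisting of the first `r = Σ_{j=0}^c (n−j+1)` monomials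
in graded lexicographic order. -/
theorem statement10 (n c : ℕ) (hn : 1 ≤ n) (hc1 : 1 ≤ c) (hcn : c ≤ n) :
    (Yset n c).ncard
        = Nat.choose (c+4) 5 + (n-c) * Nat.choose (c+3) 4
            + Nat.choose (n-c+1) 2 * Nat.choose (c+2) 3
            + Nat.choose (n-c+2) 3 * Nat.choose (c+1) 2 ∧
    (E1set n c).ncard
        = Nat.choose (n-c+1) 2
            * (Nat.choose (c+2) 3 + (n-c) * Nat.choose (c+1) 2) := by
  obtain ⟨m, rfl⟩ := Nat.exists_eq_add_of_le hcn
  have hm : c + m - c = m := by omega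
  rw [hm]
  have e1 := Sset_ncard c m 5 0
  have e2 := Sset_ncard c m 4 1
  have e3 := Sset_ncard c m 3 2
  have e4 := Sset_ncard c m 2 3
  have e5 := Sset_ncard c m 3 0
  have e6 := Sset_ncard c m 2 1
  have e7 := Sset_ncard c m 0 2
  simp only [Nat.multichoose_eq, Nat.reduceAdd, Nat.add_one_sub_one, Nat.choose_zero_right,
    Nat.choose_one_right, one_mul, mul_one, Nat.reduceSubDiff, zero_add] at e1 e2 e3 e4 e5 e6 e7
  have f := Sset_finite (c+m) c
  constructor
  · rw [Y_eq, Set.ncard_union_eq _ (f _ _) ((f _ _).union ((f _ _).union (f _ _))),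
      Set.ncard_union_eq _ (f _ _) ((f _ _).union (f _ _)),
      Set.ncard_union_eq _ (f _ _) (f _ _), e1, e2, e3, e4]
    · ring
    · exact Sset_disj _ _ _ _ _ _ (by norm_num)
    · simp only [Set.disjoint_union_right]
      exact ⟨Sset_disj _ _ _ _ _ _ (by norm_num), Sset_disj _ _ _ _ _ _ (by norm_num)⟩
    · simp only [Set.disjoint_union_right]
      exact ⟨Sset_disj _ _ _ _ _ _ (by norm_num), Sset_disj _ _ _ _ _ _ (by norm_num),
        Sset_disj _ _ _ _ _ _ (by norm_num)⟩
  · rw [E_eq, Set.ncard_prod, Set.ncard_union_eq (Sset_disj _ _ _ _ _ _ (by norm_num)) (f _ _)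
      (f _ _), e5, e6, e7]
    ring
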